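/- The family of elements of R consisting of v, w, d, ds, together with c^i and c^i*d for all integers i ≥ 1, cs^j and ds*cs^j for all integers j ≥ 1, and c^i*cs^j for all integers i, j ≥ 1, is a K-basis of R: it is linearly independent over K and its K-linear span is all of R. -/

import Mathlib

noncomputable section

/-- The defining relation `X * Y = 1` of the Jacobson algebra. -/
inductive JRel (K : Type*) [Field K] : FreeAlgebra K (Fin 2) → FreeAlgebra K (Fin 2) → Prop
  | rel : JRel K (FreeAlgebra.ι K 0 * FreeAlgebra.ι K 1) 1

/-- The Jacobson algebra `K⟨X, Y | XY = 1⟩`. -/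
abbrev Jacobson (K : Type*) [Field K] := RingQuot (JRel K)

variable (K : Type*) [Field K]

/-- The generator `X` of the Jacobson algebra. -/
def Xg : Jacobson K := RingQuot.mkAlgHom K (JRel K) (FreeAlgebra.ι K 0)

/-- The generator `Y` of the Jacobson algebra. -/
def Yg : Jacobson K := RingQuot.mkAlgHom K (JRel K) (FreeAlgebra.ι K 1)

/-- The vertex idempotent `v = YX`. -/
def vJ : Jacobson K := Yg K * Xg K

/-- The vertex idempotent `w = 1 - YX`. -/
def wJ : Jacobson K := 1 - Yg K * Xg K

/-- The loop `c = Y²X`. -/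
def cJ : Jacobson K := Yg K ^ 2 * Xg K

/-- The ghost loop `c* = YX²`. -/
def csJ : Jacobson K := Yg K * Xg K ^ 2

/-- The exit edge `d = Y - Y²X`. -/
def dJ : Jacobson K := Yg K - Yg K ^ 2 * Xg K

/-- The ghost exit edge `d* = X - YX²`. -/
def dsJ : Jacobson K := Xg K - Yg K * Xg K ^ 2

/-- Index type for the `K`-basis of the Jacobson algebra: four sporadic elements
`v, w, d, ds`; four singly-indexed families `c^(i+1)`, `c^(i+1) * d`, `cs^(j+1)`,
`ds * cs^(j+1)`; and the doubly-indexed family `c^(i+1) * cs^(j+1)`. -/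
abbrev JBasisIndex : Type := (Fin 4) ⊕ ((Fin 4) × ℕ) ⊕ (ℕ × ℕ)

/-- The basis family of the Jacobson algebra:
`v, w, d, ds`, together with `c^i` and `c^i * d` for `i ≥ 1`, `cs^j` and `ds * cs^j`
for `j ≥ 1`, and `c^i * cs^j` for `i, j ≥ 1`. -/
def jBasisFun : JBasisIndex → Jacobson K
  | Sum.inl 0 => vJ K
  | Sum.inl 1 => wJ K
  | Sum.inl 2 => dJ K
  | Sum.inl 3 => dsJ K
  | Sum.inr (Sum.inl (0, i)) => cJ K ^ (i + 1)
  | Sum.inr (Sum.inl (1, i)) => cJ K ^ (i + 1) * dJ K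
  | Sum.inr (Sum.inl (2, j)) => csJ K ^ (j + 1)
  | Sum.inr (Sum.inl (3, j)) => dsJ K * csJ K ^ (j + 1)
  | Sum.inr (Sum.inr (i, j)) => cJ K ^ (i + 1) * csJ K ^ (j + 1)

lemma XY_one : Xg K * Yg K = 1 := by
  have h := RingQuot.mkAlgHom_rel K (JRel.rel (K := K))
  rw [map_mul, map_one] at h
  exact h

lemma X_Ypow (n : ℕ) (t : Jacobson K) : Xg K * (Yg K ^ (n + 1) * t) = Yg K ^ n * t := by
  rw [pow_succ', ← mul_assoc, ← mul_assoc, XY_one, one_mul]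

/-- The monomials `Y^i X^j`. -/
def aJ (p : ℕ × ℕ) : Jacobson K := Yg K ^ p.1 * Xg K ^ p.2

lemma X_aJ_succ (i j : ℕ) : Xg K * aJ K (i + 1, j) = aJ K (i, j) := X_Ypow K i _

lemma X_aJ_zero (j : ℕ) : Xg K * aJ K (0, j) = aJ K (0, j + 1) := by
  simp [aJ, pow_succ']

lemma Y_aJ (i j : ℕ) : Yg K * aJ K (i, j) = aJ K (i + 1, j) := by
  simp [aJ, pow_succ', mul_assoc]

lemma v_eq : vJ K = aJ K (1, 1) := by simp [vJ, aJ]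
lemma w_eq : wJ K = aJ K (0, 0) - aJ K (1, 1) := by simp [wJ, aJ]
lemma d_eq : dJ K = aJ K (1, 0) - aJ K (2, 1) := by simp [dJ, aJ]
lemma ds_eq : dsJ K = aJ K (0, 1) - aJ K (1, 2) := by simp [dsJ, aJ]

lemma X_Y_assoc (t : Jacobson K) : Xg K * (Yg K * t) = t := by
  rw [← mul_assoc, XY_one, one_mul]

lemma c_pow (i : ℕ) : cJ K ^ (i + 1) = aJ K (i + 2, 1) := by
  induction i with
  | zero => simp [cJ, aJ]
  | succ n ih =>
    rw [pow_succ', ih]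
    simp only [cJ, mul_assoc, X_aJ_succ, pow_two, Y_aJ]

lemma cs_pow (i : ℕ) : csJ K ^ (i + 1) = aJ K (1, i + 2) := by
  induction i with
  | zero => simp [csJ, aJ]
  | succ n ih =>
    rw [pow_succ', ih]
    simp only [csJ, mul_assoc, pow_two, X_aJ_succ, X_aJ_zero, Y_aJ]

lemma aJ_mul (i j k : ℕ) : aJ K (i, 1) * aJ K (k + 1, j) = aJ K (i + k, j) := by
  have h : aJ K (i, 1) = Yg K ^ i * Xg K := by simp [aJ]
  rw [h, mul_assoc, X_aJ_succ]
  simp [aJ, pow_add, mul_assoc]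

lemma c_d (i : ℕ) : cJ K ^ (i + 1) * dJ K = aJ K (i + 2, 0) - aJ K (i + 3, 1) := by
  rw [c_pow, d_eq, mul_sub, aJ_mul K _ _ 0, aJ_mul K _ _ 1]

lemma ds_cs (j : ℕ) : dsJ K * csJ K ^ (j + 1) = aJ K (0, j + 2) - aJ K (1, j + 3) := by
  rw [cs_pow]
  simp only [dsJ, sub_mul, mul_assoc, pow_two, X_aJ_succ, X_aJ_zero, Y_aJ]

lemma c_cs (i j : ℕ) : cJ K ^ (i + 1) * csJ K ^ (j + 1) = aJ K (i + 2, j + 2) := by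
  rw [c_pow, cs_pow, aJ_mul K _ _ 0]

/-- The action of `X` on the space with basis `Y^i X^j`. -/
def xAct : Module.End K ((ℕ × ℕ) →₀ K) :=
  Finsupp.lmapDomain K K (fun p => match p with
    | (0, j) => (0, j + 1)
    | (i + 1, j) => (i, j))

/-- The action of `Y` on the space with basis `Y^i X^j`. -/
def yAct : Module.End K ((ℕ × ℕ) →₀ K) :=
  Finsupp.lmapDomain K K (fun p => (p.1 + 1, p.2))

lemma xy_act : xAct K * yAct K = 1 := by
  ext p : 1
  ext
  simp [xAct, yAct, Finsupp.mapDomain_single]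

/-- The left regular representation. -/
def rep : Jacobson K →ₐ[K] Module.End K ((ℕ × ℕ) →₀ K) :=
  RingQuot.liftAlgHom K ⟨FreeAlgebra.lift K ![xAct K, yAct K], by
    rintro _ _ ⟨⟩
    simp [xy_act]⟩

lemma rep_X : rep K (Xg K) = xAct K := by simp [rep, Xg]
lemma rep_Y : rep K (Yg K) = yAct K := by simp [rep, Yg]

/-- Evaluation of the representation at the unit monomial. -/
def evJ : Jacobson K →ₗ[K] ((ℕ × ℕ) →₀ K) :=
  (LinearMap.applyₗ (Finsupp.single ((0, 0) : ℕ × ℕ) (1 : K))).comp (rep K).toLinearMap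

lemma ev_mul (a b : Jacobson K) : evJ K (a * b) = rep K a (evJ K b) := by
  simp [evJ]

lemma ev_aJ (p : ℕ × ℕ) : evJ K (aJ K p) = Finsupp.single p 1 := by
  obtain ⟨i, j⟩ := p
  induction i with
  | zero =>
    induction j with
    | zero => simp [aJ, evJ]
    | succ n ih =>
      rw [← X_aJ_zero, ev_mul, ih, rep_X]
      simp [xAct, Finsupp.mapDomain_single]
  | succ n ih =>
    rw [← Y_aJ, ev_mul, ih, rep_Y]
    simp [yAct, Finsupp.mapDomain_single]

/-- Index of the monomial `Y^(i+1) X^(j+1)`. -/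
def idx : ℕ → ℕ → JBasisIndex
  | 0, 0 => Sum.inl 0
  | i + 1, 0 => Sum.inr (Sum.inl (0, i))
  | 0, j + 1 => Sum.inr (Sum.inl (2, j))
  | i + 1, j + 1 => Sum.inr (Sum.inr (i, j))

/-- Index of `Y^i X^j - Y^(i+1) X^(j+1)` when `i = 0` or `j = 0` (of `Y^i X^j` otherwise). -/
def idx0 : ℕ → ℕ → JBasisIndex
  | 0, 0 => Sum.inl 1
  | 1, 0 => Sum.inl 2
  | 0, 1 => Sum.inl 3
  | i + 2, 0 => Sum.inr (Sum.inl (1, i))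
  | 0, j + 2 => Sum.inr (Sum.inl (3, j))
  | i + 1, j + 1 => idx i j

lemma f_idx (i j : ℕ) : jBasisFun K (idx i j) = aJ K (i + 1, j + 1) := by
  rcases i with _ | i <;> rcases j with _ | j <;>
    simp [idx, jBasisFun, v_eq, c_pow, cs_pow, aJ_mul K _ _ 0]

lemma f_left (i : ℕ) : jBasisFun K (idx0 i 0) = aJ K (i, 0) - aJ K (i + 1, 1) := by
  rcases i with _ | _ | i
  · exact w_eq K
  · exact d_eq K
  · exact c_d K i

lemma f_right (j : ℕ) : jBasisFun K (idx0 0 j) = aJ K (0, j) - aJ K (1, j + 1) := by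
  rcases j with _ | _ | j
  · exact w_eq K
  · exact ds_eq K
  · exact ds_cs K j

/-- Expansion of the monomials in the basis. -/
def expJ : ℕ × ℕ → (JBasisIndex →₀ K)
  | (i + 1, j + 1) => Finsupp.single (idx i j) 1
  | (i, 0) => Finsupp.single (idx0 i 0) 1 + Finsupp.single (idx i 0) 1
  | (0, j) => Finsupp.single (idx0 0 j) 1 + Finsupp.single (idx 0 j) 1

/-- Coordinates. -/
def coordJ : Jacobson K →ₗ[K] (JBasisIndex →₀ K) :=
  (Finsupp.linearCombination K (expJ K)).comp (evJ K)

lemma coord_aJ (p : ℕ × ℕ) : coordJ K (aJ K p) = expJ K p := by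
  simp [coordJ, ev_aJ]

lemma idx_cases (s : JBasisIndex) :
    (∃ i j, s = idx i j) ∨ (∃ i, s = idx0 i 0) ∨ (∃ j, s = idx0 0 j) := by
  rcases s with k | ⟨k, i⟩ | ⟨i, j⟩
  · fin_cases k
    · exact .inl ⟨0, 0, rfl⟩
    · exact .inr (.inl ⟨0, rfl⟩)
    · exact .inr (.inl ⟨1, rfl⟩)
    · exact .inr (.inr ⟨1, rfl⟩)
  · fin_cases k
    · exact .inl ⟨i + 1, 0, rfl⟩
    · exact .inr (.inl ⟨i + 2, rfl⟩)
    · exact .inl ⟨0, i + 1, rfl⟩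
    · exact .inr (.inr ⟨i + 2, rfl⟩)
  · exact .inl ⟨i + 1, j + 1, rfl⟩

lemma coord_f (s : JBasisIndex) : coordJ K (jBasisFun K s) = Finsupp.single s 1 := by
  rcases idx_cases s with ⟨i, j, rfl⟩ | ⟨i, rfl⟩ | ⟨j, rfl⟩
  · rw [f_idx, coord_aJ]; rfl
  · rw [f_left, map_sub, coord_aJ, coord_aJ]
    rcases i with _ | i <;> simp [expJ]
  · rw [f_right, map_sub, coord_aJ, coord_aJ]
    rcases j with _ | j <;> simp [expJ]

lemma aJ_mem (p : ℕ × ℕ) : aJ K p ∈ Submodule.span K (Set.range (jBasisFun K)) := by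
  have key : ∀ s, jBasisFun K s ∈ Submodule.span K (Set.range (jBasisFun K)) :=
    fun s => Submodule.subset_span ⟨s, rfl⟩
  have h1 : ∀ i j, aJ K (i + 1, j + 1) ∈ Submodule.span K (Set.range (jBasisFun K)) :=
    fun i j => f_idx K i j ▸ key _
  obtain ⟨i, j⟩ := p
  rcases j with _ | j
  · have := Submodule.add_mem _ (key (idx0 i 0)) (h1 i 0)
    rwa [f_left, zero_add, sub_add_cancel] at this
  · rcases i with _ | i
    · have := Submodule.add_mem _ (key (idx0 0 (j + 1))) (h1 0 (j + 1))
      rwa [f_right, zero_add, sub_add_cancel] at this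
    · exact h1 i j

lemma span_aJ : Submodule.span K (Set.range (aJ K)) = ⊤ := by
  have hgen : ∀ (a : Jacobson K), (∀ p, a * aJ K p ∈ Set.range (aJ K)) →
      ∀ t ∈ Submodule.span K (Set.range (aJ K)), a * t ∈ Submodule.span K (Set.range (aJ K)) := by
    intro a ha t ht
    have : Submodule.span K (Set.range (aJ K)) ≤
        (Submodule.span K (Set.range (aJ K))).comap (LinearMap.mulLeft K a) := by
      rw [Submodule.span_le]
      rintro _ ⟨p, rfl⟩
      exact Submodule.subset_span (ha p)
    exact this ht
  have hX := hgen (Xg K) (by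
    rintro ⟨_ | i, j⟩
    · exact ⟨_, (X_aJ_zero K j).symm⟩
    · exact ⟨_, (X_aJ_succ K i j).symm⟩)
  have hY := hgen (Yg K) (by
    rintro ⟨i, j⟩
    exact ⟨_, (Y_aJ K i j).symm⟩)
  have hall : ∀ (r : FreeAlgebra K (Fin 2)), ∀ t ∈ Submodule.span K (Set.range (aJ K)),
      RingQuot.mkAlgHom K (JRel K) r * t ∈ Submodule.span K (Set.range (aJ K)) := by
    intro r
    induction r using FreeAlgebra.induction with
    | grade0 k =>
      intro t ht
      rw [AlgHom.commutes, ← Algebra.smul_def]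
      exact Submodule.smul_mem _ _ ht
    | grade1 x =>
      fin_cases x
      · exact hX
      · exact hY
    | mul a b ha hb =>
      intro t ht
      rw [map_mul, mul_assoc]
      exact ha _ (hb _ ht)
    | add a b ha hb =>
      intro t ht
      rw [map_add, add_mul]
      exact Submodule.add_mem _ (ha _ ht) (hb _ ht)
  rw [eq_top_iff]
  intro x _
  obtain ⟨r, rfl⟩ := RingQuot.mkAlgHom_surjective K (JRel K) x
  have := hall r 1 (Submodule.subset_span ⟨(0, 0), by simp [aJ]⟩)
  rwa [mul_one] at this

/-- The family `v, w, d, ds, c^i (i ≥ 1), c^i d (i ≥ 1), cs^j (j ≥ 1), ds cs^j (j ≥ 1),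
c^i cs^j (i, j ≥ 1)` is a `K`-basis of the Jacobson algebra: it is `K`-linearly
independent and spans the whole algebra over `K`. -/
theorem jacobson_basis :
    LinearIndependent K (jBasisFun K) ∧
      Submodule.span K (Set.range (jBasisFun K)) = ⊤ := by
  refine ⟨?_, ?_⟩
  · apply LinearIndependent.of_comp (coordJ K)
    have h : (coordJ K) ∘ (jBasisFun K) = fun s => Finsupp.single s (1 : K) := by
      funext s
      exact coord_f K s
    rw [h]
    exact Finsupp.linearIndependent_single_one K JBasisIndex
  · rw [eq_top_iff, ← span_aJ K, Submodule.span_le]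
    rintro _ ⟨p, rfl⟩
    exact aJ_mem K p
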